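/- Let (α_z)_{z∈ℂ} be an analytic one-parameter group on A relative to φ, with A ≠ {0}, and assume in addition that A is spanned by products, i.e. A = span{a·b : a, b ∈ A}. Then the relative invariance extends to complex parameters: φ(α_z(a)) = λ^z · φ(a) for every z ∈ ℂ and every a ∈ A, where λ^z = exp(z · log λ). -/

import Mathlib

open scoped ComplexOrder

/-- An analytic one-parameter group on a (not necessarily unital) complex `*`-algebra `A`,
relative to a linear functional `φ` : a family `(α z)_{z ∈ ℂ}` of algebra homomorphisms
`A → A` such that each `α t` (`t` real) is a `*`-automorphism, the real group law holds,
each real `α t` scales `φ` by a strictly positive constant, and all the functions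
`z ↦ φ (b * α z a)` and `z ↦ φ (α z a * b)` are entire. -/
structure AnalyticOneParamGroup {A : Type*} [NonUnitalRing A] [Module ℂ A]
    [SMulCommClass ℂ A A] [IsScalarTower ℂ A A] [StarRing A] [StarModule ℂ A]
    (φ : A →ₗ[ℂ] ℂ) (α : ℂ → A → A) : Prop where
  map_add : ∀ (z : ℂ) (a b : A), α z (a + b) = α z a + α z b
  map_smul : ∀ (z : ℂ) (c : ℂ) (a : A), α z (c • a) = c • α z a
  map_mul : ∀ (z : ℂ) (a b : A), α z (a * b) = α z a * α z b
  real_star : ∀ (t : ℝ) (a : A), α (t : ℂ) (star a) = star (α (t : ℂ) a)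
  real_bijective : ∀ t : ℝ, Function.Bijective (α (t : ℂ))
  real_group : ∀ (s t : ℝ) (a : A), α ((s : ℂ) + (t : ℂ)) a = α (s : ℂ) (α (t : ℂ) a)
  real_rel_invariant : ∀ t : ℝ, ∃ c : ℝ, 0 < c ∧ ∀ a : A, φ (α (t : ℂ) a) = (c : ℂ) * φ a
  entire_left : ∀ a b : A, Differentiable ℂ fun z : ℂ => φ (b * α z a)
  entire_right : ∀ a b : A, Differentiable ℂ fun z : ℂ => φ (α z a * b)

/-- Two entire functions that agree on the real line are equal. -/
theorem Differentiable.eq_of_eq_ofReal {f g : ℂ → ℂ} (hf : Differentiable ℂ f)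
    (hg : Differentiable ℂ g) (h : ∀ t : ℝ, f t = g t) : f = g := by
  have hfa : AnalyticOnNhd ℂ f Set.univ := fun z _ => hf.analyticAt z
  have hga : AnalyticOnNhd ℂ g Set.univ := fun z _ => hg.analyticAt z
  refine hfa.eq_of_frequently_eq hga (z₀ := 0) ?_
  have hT : Filter.Tendsto (fun t : ℝ => (t : ℂ)) (nhdsWithin 0 {0}ᶜ) (nhdsWithin 0 {0}ᶜ) := by
    refine tendsto_nhdsWithin_iff.2 ⟨?_, ?_⟩
    · exact (Complex.continuous_ofReal.tendsto' 0 0 Complex.ofReal_zero).mono_left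
        nhdsWithin_le_nhds
    · filter_upwards [self_mem_nhdsWithin] with t ht
      simpa using ht
  exact hT.frequently (Filter.Eventually.of_forall h).frequently

namespace AnalyticOneParamGroup

variable {A : Type*} [NonUnitalRing A] [Module ℂ A]
    [SMulCommClass ℂ A A] [IsScalarTower ℂ A A] [StarRing A] [StarModule ℂ A]
    {φ : A →ₗ[ℂ] ℂ} {α : ℂ → A → A}

theorem apply_zero (hα : AnalyticOneParamGroup φ α) (a : A) : α 0 a = a := by
  have hinj := (hα.real_bijective 0).injective
  have h := hα.real_group 0 0 a
  simp only [Complex.ofReal_zero, add_zero] at hinj h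
  exact (hinj h).symm

/-- Relative invariance for a product whose factors are moved by independent parameters. -/
theorem apply_mul_apply (hα : AnalyticOneParamGroup φ α) {c : ℂ}
    (hc : ∀ (t : ℝ) (a : A), φ (α t a) = Complex.exp (t * c) * φ a) (a b : A) (z w : ℂ) :
    φ (α z a * α w b) = Complex.exp (z * c) * φ (a * α (w - z) b) := by
  have real_left (t : ℝ) :
      (fun w : ℂ => φ (α t a * α w b)) =
        fun w => Complex.exp (t * c) * φ (a * α (w - t) b) := by
    refine Differentiable.eq_of_eq_ofReal (hα.entire_left b (α t a))
      (((hα.entire_left b a).comp (differentiable_id.sub_const (t : ℂ))).const_mul _)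
      fun s => ?_
    have h := hα.real_group t (s - t) b
    push_cast at h
    rw [add_sub_cancel] at h
    rw [h, ← hα.map_mul, hc]
  refine congrFun (Differentiable.eq_of_eq_ofReal
    (f := fun z => φ (α z a * α w b))
    (g := fun z => Complex.exp (z * c) * φ (a * α (w - z) b))
    (hα.entire_right a (α w b)) ?_ fun t => congrFun (real_left t) w) z
  exact (differentiable_id.mul_const c).cexp.mul
    ((hα.entire_left b a).comp (differentiable_id.const_sub w))

end AnalyticOneParamGroup

/-- If `A ≠ {0}` and `A` is spanned by products, the relative invariance
`φ ∘ α t = λ ^ t * φ` extends to complex parameters : `φ (α z a) = exp (z * log λ) * φ a`. -/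
theorem analyticOneParamGroup_rel_invariant_complex {A : Type*} [NonUnitalRing A] [Module ℂ A]
    [SMulCommClass ℂ A A] [IsScalarTower ℂ A A] [StarRing A] [StarModule ℂ A]
    (φ : A →ₗ[ℂ] ℂ)
    (hpos : ∀ a : A, 0 ≤ φ (star a * a))
    (hfaith : ∀ a : A, φ (star a * a) = 0 → a = 0)
    (α : ℂ → A → A) (hα : AnalyticOneParamGroup φ α)
    (hA : ∃ a : A, a ≠ 0)
    (lam : ℝ) (hlam_pos : 0 < lam)
    (hlam : ∀ (t : ℝ) (a : A), φ (α (t : ℂ) a) = ((lam ^ t : ℝ) : ℂ) * φ a)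
    (hspan : Submodule.span ℂ {x : A | ∃ a b : A, x = a * b} = ⊤)
    (z : ℂ) (a : A) :
    φ (α z a) = Complex.exp (z * Real.log lam) * φ a := by
  have hc (t : ℝ) (a : A) : φ (α t a) = Complex.exp (t * Real.log lam) * φ a := by
    rw [hlam, Real.rpow_def_of_pos hlam_pos, mul_comm (Real.log lam)]
    push_cast
    rfl
  have ha : a ∈ Submodule.span ℂ {x : A | ∃ a b : A, x = a * b} := hspan ▸ Submodule.mem_top
  induction ha using Submodule.span_induction with
  | mem x hx =>
    obtain ⟨a, b, rfl⟩ := hx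
    rw [hα.map_mul, hα.apply_mul_apply hc, sub_self, hα.apply_zero]
  | zero =>
    have h := hα.map_smul z 0 0
    rw [zero_smul, zero_smul] at h
    rw [h, map_zero, mul_zero]
  | add x y _ _ hx hy => rw [hα.map_add, map_add, map_add, hx, hy, mul_add]
  | smul k x _ hx =>
    rw [hα.map_smul, map_smul, map_smul, hx, smul_eq_mul, smul_eq_mul, mul_left_comm]
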